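/- arXiv:2305.05986 — 3 statements merged into one kernel-verified Lean document; each statement's English description precedes it below -/
import Mathlib

section
/- Let μ_X > 0, μ_Y > 0 and α > 0 be real numbers, and let p : ℕ × ℕ → ℝ be the forward-model joint pmf p(x,y) = (e^{-μ_X} μ_X^x / x!) · (e^{-(αx+μ_Y)} (αx+μ_Y)^y / y!). Then there do not exist real numbers α̂ ≥ 0, μ̂_X ≥ 0, μ̂_Y ≥ 0 such that for all x, y ∈ ℕ, p(x,y) = (e^{-μ̂_Y} μ̂_Y^y / y!) · (e^{-(α̂ y + μ̂_X)} (α̂ y + μ̂_X)^x / x!). In other words, the bivariate instantaneous Poisson causal model X → Y admits no distribution-equivalent backward model Y → X. -/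
/-- The bivariate instantaneous Poisson causal model `X → Y` admits no
distribution-equivalent backward model `Y → X`. -/
theorem no_backward_model (μX μY α : ℝ) (hμX : 0 < μX) (hμY : 0 < μY) (hα : 0 < α) :
    ¬ ∃ (αh μXh μYh : ℝ), 0 ≤ αh ∧ 0 ≤ μXh ∧ 0 ≤ μYh ∧
      ∀ x y : ℕ,
        (Real.exp (-μX) * μX ^ x / (Nat.factorial x : ℝ)) *
          (Real.exp (-(α * (x : ℝ) + μY)) * (α * (x : ℝ) + μY) ^ y / (Nat.factorial y : ℝ)) =
        (Real.exp (-μYh) * μYh ^ y / (Nat.factorial y : ℝ)) *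
          (Real.exp (-(αh * (y : ℝ) + μXh)) * (αh * (y : ℝ) + μXh) ^ x / (Nat.factorial x : ℝ)) := by
  rintro ⟨b, c, d, -, -, -, h⟩
  have e1 : Real.exp (-(α + μY)) = Real.exp (-α) * Real.exp (-μY) := by
    rw [← Real.exp_add]; ring_nf
  have e2 : Real.exp (-(b + c)) = Real.exp (-b) * Real.exp (-c) := by
    rw [← Real.exp_add]; ring_nf
  have e3 : Real.exp (-(b * 2 + c)) = Real.exp (-b) * Real.exp (-b) * Real.exp (-c) := by
    rw [← Real.exp_add, ← Real.exp_add]; ring_nf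
  have h00 := h 0 0
  have h01 := h 0 1
  have h10 := h 1 0
  have h11 := h 1 1
  have h12 := h 1 2
  simp only [Nat.cast_zero, Nat.cast_one, Nat.cast_ofNat, mul_zero, mul_one, zero_add, pow_zero,
    pow_one, Nat.factorial, div_one, e1, e2, e3, Nat.reduceMul, Nat.reduceAdd, Nat.succ_eq_add_one,
    Nat.cast_succ] at h00 h01 h10 h11 h12
  clear h e1 e2 e3
  have pA : 0 < Real.exp (-μX) * Real.exp (-μY) := by positivity
  have ps : 0 < Real.exp (-α) := Real.exp_pos _
  generalize Real.exp (-α) = s at *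
  generalize Real.exp (-b) = t at *
  generalize Real.exp (-μX) = A1 at *
  generalize Real.exp (-μY) = A2 at *
  generalize Real.exp (-c) = D1 at *
  generalize Real.exp (-d) = D2 at *
  have k1 : μY = d * t := by
    apply mul_left_cancel₀ pA.ne'
    linear_combination h01 - d * t * h00
  have k2 : μX * s = c := by
    apply mul_left_cancel₀ pA.ne'
    linear_combination h10 - c * h00
  have k3 : c * (α + μY) = μY * (b + c) := by
    apply mul_left_cancel₀ pA.ne'
    rw [← k2] at h11 ⊢
    rw [k1] at h11 ⊢
    linear_combination h11 - d * t * (b + μX * s) * h00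
  have k4 : c * (α + μY) ^ 2 = μY ^ 2 * (b * 2 + c) := by
    apply mul_left_cancel₀ pA.ne'
    rw [← k2] at h12 ⊢
    rw [k1] at h12 ⊢
    linear_combination 2 * h12 - (d * t) ^ 2 * (b * 2 + μX * s) * h00
  have hc : 0 < c := by rw [← k2]; positivity
  have : c * α ^ 2 = 0 := by linear_combination k4 - 2 * μY * k3
  have : 0 < c * α ^ 2 := by positivity
  linarith
end

section
/- Let μ_X > 0, μ_Y ≥ 0 and α > 0 be real numbers, and let p : ℕ × ℕ → ℝ be the forward-model joint pmf p(x,y) = (e^{-μ_X} μ_X^x / x!) · (e^{-(αx+μ_Y)} (αx+μ_Y)^y / y!). Then the marginal distribution of Y is not Poisson: for every real λ ≥ 0 there exists y ∈ ℕ such that Σ_{x=0}^{∞} p(x,y) ≠ e^{-λ} λ^y / y!. -/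
/-- In the forward model, the marginal distribution of `Y` is not Poisson. -/
theorem marginal_not_poisson (μX μY α : ℝ) (hμX : 0 < μX) (hμY : 0 ≤ μY) (hα : 0 < α) :
    ∀ lam : ℝ, 0 ≤ lam → ∃ y : ℕ,
      (∑' x : ℕ,
        (Real.exp (-μX) * μX ^ x / (Nat.factorial x : ℝ)) *
          (Real.exp (-(α * (x : ℝ) + μY)) * (α * (x : ℝ) + μY) ^ y / (Nat.factorial y : ℝ)))
      ≠ Real.exp (-lam) * lam ^ y / (Nat.factorial y : ℝ) := by
  intro lam hlam
  by_contra! H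
  rcases hlam.eq_or_lt with h0 | hpos
  · subst h0
    have h := H 0
    have hs : HasSum (fun x : ℕ => (Real.exp (-μX) * μX ^ x / (Nat.factorial x : ℝ)) *
          (Real.exp (-(α * (x : ℝ) + μY)) * (α * (x : ℝ) + μY) ^ 0 / (Nat.factorial 0 : ℝ)))
        (Real.exp (-μX - μY) * Real.exp (μX * Real.exp (-α))) := by
      have h1 := (NormedSpace.expSeries_div_hasSum_exp (μX * Real.exp (-α))).mul_left
        (Real.exp (-μX - μY))
      rw [← Real.exp_eq_exp_ℝ] at h1
      refine Eq.subst (motive := fun f => HasSum f _) (funext fun x => ?_) h1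
      symm
      have e1 : Real.exp (-(α * (x : ℝ) + μY)) = Real.exp (-α) ^ x * Real.exp (-μY) := by
        rw [← Real.exp_nat_mul, ← Real.exp_add]; congr 1; ring
      rw [e1, sub_eq_add_neg, Real.exp_add, mul_pow]
      simp
      ring
    rw [hs.tsum_eq, ← Real.exp_add] at h
    simp at h
    have : Real.exp (-α) < 1 := by rw [Real.exp_lt_one_iff]; linarith
    nlinarith
  · obtain ⟨n, hn⟩ := exists_nat_gt (lam / α)
    rw [div_lt_iff₀ hα] at hn
    set a : ℝ := α * (n : ℝ) + μY with ha
    have hla : lam < a := by rw [ha]; linarith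
    set c : ℝ := (Real.exp (-μX) * μX ^ n / (Nat.factorial n : ℝ)) * Real.exp (-a) with hc
    have hcpos : 0 < c := by positivity
    have key : ∀ y : ℕ, c * a ^ y ≤ Real.exp (-lam) * lam ^ y := by
      intro y
      have h := H y
      have hf : (0 : ℝ) < (Nat.factorial y : ℝ) := by positivity
      have hs : Summable (fun x : ℕ => (Real.exp (-μX) * μX ^ x / (Nat.factorial x : ℝ)) *
          (Real.exp (-(α * (x : ℝ) + μY)) * (α * (x : ℝ) + μY) ^ y / (Nat.factorial y : ℝ))) := by
        by_contra hns
        rw [tsum_eq_zero_of_not_summable hns] at h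
        have : 0 < Real.exp (-lam) * lam ^ y / (Nat.factorial y : ℝ) := by positivity
        linarith
      have hle := hs.le_tsum n (fun j _ => by positivity)
      rw [h, ← ha] at hle
      have : c * a ^ y / (Nat.factorial y : ℝ)
          ≤ Real.exp (-lam) * lam ^ y / (Nat.factorial y : ℝ) := by
        refine le_trans (le_of_eq ?_) hle
        rw [hc]; ring
      exact (div_le_div_iff_of_pos_right hf).1 this
    obtain ⟨y, hy⟩ := pow_unbounded_of_one_lt (Real.exp (-lam) / c) ((one_lt_div hpos).2 hla)
    have hk := key y
    rw [div_pow, div_lt_div_iff₀ hcpos (by positivity)] at hy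
    linarith
end

section
/- Let α ≥ 0 and μ > 0 be real numbers. If for all x ∈ ℕ and all y ∈ ℕ, y · (log(α(x+2) + μ) − 2·log(α(x+1) + μ) + log(αx + μ)) = 0, then α = 0. -/
/-- If the second difference condition holds for all `x, y ∈ ℕ`, then `α = 0`. -/
theorem second_difference_forces_zero (α μ : ℝ) (hα : 0 ≤ α) (hμ : 0 < μ)
    (h : ∀ x y : ℕ,
      (y : ℝ) *
        (Real.log (α * ((x : ℝ) + 2) + μ) - 2 * Real.log (α * ((x : ℝ) + 1) + μ) +
          Real.log (α * (x : ℝ) + μ)) = 0) :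
    α = 0 := by
  have h0 := h 0 1
  simp only [Nat.cast_one, Nat.cast_zero, one_mul, zero_add, mul_one, mul_zero] at h0
  have h1 : 0 < α * 2 + μ := by positivity
  have h2 : 0 < α + μ := by positivity
  have h3 : Real.log ((α * 2 + μ) * μ) = Real.log ((α + μ) * (α + μ)) := by
    rw [Real.log_mul h1.ne' hμ.ne', Real.log_mul h2.ne' h2.ne']
    linarith
  have h4 : (α * 2 + μ) * μ = (α + μ) * (α + μ) :=
    Real.log_injOn_pos (Set.mem_Ioi.2 (mul_pos h1 hμ)) (Set.mem_Ioi.2 (mul_pos h2 h2)) h3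
  have h5 : α ^ 2 = 0 := by linarith
  exact pow_eq_zero_iff (two_ne_zero) |>.1 h5
end
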